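/- arXiv:2601.01710 — 7 statements merged into one kernel-verified Lean document; each statement's English description precedes it below -/
import Mathlib

section
/- Let p ∈ (0,1), λ ∈ ℤ, w_T ∈ ℤ, and let Z be a ℤ-valued random variable with distribution DLap(p). Then the bias E[1{w_T + Z < λ}] - 1{w_T < λ} equals -p^{λ - w_T}/(1+p) if w_T < λ, and equals p^{w_T - λ + 1}/(1+p) if w_T ≥ λ. -/
open MeasureTheory ProbabilityTheory

/-- The probability mass of the discrete Laplace distribution `DLap(p)` at `i : ℤ`,
namely `((1-p)/(1+p)) * p^|i|`. -/
noncomputable def dlapMass (p : ℝ) (i : ℤ) : ℝ := ((1 - p) / (1 + p)) * p ^ i.natAbs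

/-- Upper tail of the discrete Laplace distribution: `P(Z ≥ n) = p^n / (1 + p)` for `n : ℕ`. -/
theorem measureReal_natCast_le_of_dlapMass
    {Ω : Type*} [MeasurableSpace Ω] (μ : Measure Ω)
    {p : ℝ} (hp : p ∈ Set.Ioo (0 : ℝ) 1)
    {Z : Ω → ℤ} (hZmeas : Measurable Z)
    (hZ : ∀ i : ℤ, μ {ω | Z ω = i} = ENNReal.ofReal (dlapMass p i)) (n : ℕ) :
    μ.real {ω | (n : ℤ) ≤ Z ω} = p ^ n / (1 + p) := by
  obtain ⟨hp0, hp1⟩ := hp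
  have hset : {ω | (n : ℤ) ≤ Z ω} = ⋃ k : ℕ, {ω | Z ω = ((n + k : ℕ) : ℤ)} := by
    ext ω
    simp only [Set.mem_ofPred_eq, Set.mem_iUnion]
    exact ⟨fun h => ⟨(Z ω - n).toNat, by omega⟩, fun ⟨k, hk⟩ => by omega⟩
  have hdisj : Pairwise fun j k : ℕ =>
      Disjoint {ω | Z ω = ((n + j : ℕ) : ℤ)} {ω | Z ω = ((n + k : ℕ) : ℤ)} := by
    intro j k hjk
    refine Set.disjoint_left.2 fun ω hj hk => hjk ?_
    simp only [Set.mem_ofPred_eq] at hj hk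
    omega
  have hmass (k : ℕ) :
      dlapMass p ((n + k : ℕ) : ℤ) = (1 - p) / (1 + p) * p ^ n * p ^ k := by
    rw [dlapMass, Int.natAbs_natCast, pow_add, mul_assoc]
  have hnonneg : 0 ≤ (1 - p) / (1 + p) * p ^ n := by
    have := sub_pos.2 hp1
    positivity
  have hsum : HasSum (fun k : ℕ => (1 - p) / (1 + p) * p ^ n * p ^ k) (p ^ n / (1 + p)) := by
    have hvalue : p ^ n / (1 + p) = (1 - p) / (1 + p) * p ^ n * (1 - p)⁻¹ := by
      have : 1 - p ≠ 0 := (sub_pos.2 hp1).ne'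
      field_simp
    rw [hvalue]
    exact (hasSum_geometric_of_lt_one hp0.le hp1).mul_left _
  rw [measureReal_def, hset,
    measure_iUnion hdisj fun k => hZmeas (measurableSet_singleton _)]
  simp only [hZ, hmass]
  rw [← ENNReal.ofReal_tsum_of_nonneg (fun k => by positivity) hsum.summable, hsum.tsum_eq,
    ENNReal.toReal_ofReal (by positivity)]

/-- Bias of the below-threshold indicator estimator under discrete Laplace noise. -/
theorem bias_indicator_below_threshold
    {Ω : Type*} [MeasurableSpace Ω] (μ : Measure Ω) [IsProbabilityMeasure μ]
    (p : ℝ) (hp : p ∈ Set.Ioo (0 : ℝ) 1) (lam wT : ℤ)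
    (Z : Ω → ℤ) (hZmeas : Measurable Z)
    (hZ : ∀ i : ℤ, μ {ω | Z ω = i} = ENNReal.ofReal (dlapMass p i)) :
    (∫ ω, (if wT + Z ω < lam then (1 : ℝ) else 0) ∂μ)
        - (if wT < lam then (1 : ℝ) else 0) =
      if wT < lam then -(p ^ (lam - wT) / (1 + p))
      else p ^ (wT - lam + 1) / (1 + p) := by
  have hint : ∫ ω, (if wT + Z ω < lam then (1 : ℝ) else 0) ∂μ = μ.real {ω | wT + Z ω < lam} := by
    have hmeas : MeasurableSet {ω | wT + Z ω < lam} := hZmeas.const_add wT measurableSet_Iio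
    rw [← integral_indicator_one hmeas]
    simp only [Set.indicator_apply, Set.mem_ofPred_eq, Pi.one_apply]
  rw [hint]
  split_ifs with h
  · obtain ⟨n, hn⟩ : ∃ n : ℕ, lam - wT = n := ⟨(lam - wT).toNat, by omega⟩
    have hcompl : {ω | wT + Z ω < lam} = {ω | (n : ℤ) ≤ Z ω}ᶜ := by
      ext ω
      simp only [Set.mem_ofPred_eq, Set.mem_compl_iff]
      omega
    have hmeas : MeasurableSet {ω | (n : ℤ) ≤ Z ω} := hZmeas measurableSet_Ici
    rw [hcompl, probReal_compl_eq_one_sub hmeas,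
      measureReal_natCast_le_of_dlapMass μ hp hZmeas hZ, hn, zpow_natCast]
    ring
  · obtain ⟨n, hn⟩ : ∃ n : ℕ, wT - lam + 1 = n := ⟨(wT - lam + 1).toNat, by omega⟩
    have hneg : {ω | wT + Z ω < lam} = {ω | (n : ℤ) ≤ -Z ω} := by
      ext ω
      simp only [Set.mem_ofPred_eq]
      omega
    have hZneg (i : ℤ) : μ {ω | -Z ω = i} = ENNReal.ofReal (dlapMass p i) := by
      simpa [dlapMass, neg_eq_iff_eq_neg] using hZ (-i)
    rw [hneg, measureReal_natCast_le_of_dlapMass μ hp hZmeas.fun_neg hZneg, hn, zpow_natCast, sub_zero]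
end

section
/- Let p ∈ (0,1), λ ∈ ℤ, w_T ∈ ℤ, and let Z be a ℤ-valued random variable with distribution DLap(p). Then |E[1{w_T + Z < λ}] - 1{w_T < λ}| ≤ p/(1+p). -/
open MeasureTheory ProbabilityTheory

theorem dlapMass_neg (p : ℝ) (i : ℤ) : dlapMass p (-i) = dlapMass p i := by
  simp [dlapMass]

section Tails

variable {Ω : Type*} [MeasurableSpace Ω] {μ : Measure Ω} {p : ℝ} {Z : Ω → ℤ}

/-- A discrete Laplace random variable has a symmetric distribution. -/
theorem map_neg_eq_map_of_dlap (hZmeas : Measurable Z)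
    (hZ : ∀ i : ℤ, μ {ω | Z ω = i} = ENNReal.ofReal (dlapMass p i)) :
    μ.map (-Z) = μ.map Z := by
  refine Measure.ext_of_singleton fun i => ?_
  have h_neg : (-Z) ⁻¹' {i} = {ω | Z ω = -i} := by
    ext ω
    simp [neg_eq_iff_eq_neg]
  rw [Measure.map_apply hZmeas.neg (measurableSet_singleton i),
    Measure.map_apply hZmeas (measurableSet_singleton i), h_neg, hZ, dlapMass_neg, ← hZ]
  rfl

theorem measureReal_neg_eq_measureReal_pos_of_dlap (hZmeas : Measurable Z)
    (hZ : ∀ i : ℤ, μ {ω | Z ω = i} = ENNReal.ofReal (dlapMass p i)) :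
    μ.real {ω | Z ω < 0} = μ.real {ω | 0 < Z ω} := by
  have h := congrArg (fun ν => ν (Set.Ioi 0)) (map_neg_eq_map_of_dlap hZmeas hZ)
  simp only [Measure.map_apply hZmeas.neg measurableSet_Ioi,
    Measure.map_apply hZmeas measurableSet_Ioi] at h
  simpa [measureReal_def, Set.preimage] using congrArg ENNReal.toReal h

/-- The upper tail of the discrete Laplace distribution. -/
theorem measureReal_pos_of_dlap [IsProbabilityMeasure μ] (hp : p ∈ Set.Ioo (0 : ℝ) 1)
    (hZmeas : Measurable Z)
    (hZ : ∀ i : ℤ, μ {ω | Z ω = i} = ENNReal.ofReal (dlapMass p i)) :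
    μ.real {ω | 0 < Z ω} = p / (1 + p) := by
  obtain ⟨hp0, hp1⟩ := hp
  have h_zero : μ.real {ω | Z ω = 0} = (1 - p) / (1 + p) := by
    rw [measureReal_def, hZ, ENNReal.toReal_ofReal] <;> simp only [dlapMass, Int.natAbs_zero,
      pow_zero, mul_one]
    exact div_nonneg (by linarith) (by linarith)
  have h_compl := probReal_compl_eq_one_sub (μ := μ)
    (measurableSet_lt hZmeas (measurable_const (a := (0 : ℤ))))
  have h_union : {ω | Z ω < 0}ᶜ = {ω | Z ω = 0} ∪ {ω | 0 < Z ω} := by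
    ext ω
    simp [le_iff_eq_or_lt, eq_comm]
  have h_disj : Disjoint {ω | Z ω = 0} {ω | 0 < Z ω} :=
    Set.disjoint_left.2 fun ω h₀ h₁ => h₁.ne' h₀
  rw [h_union, measureReal_union h_disj (measurableSet_lt measurable_const hZmeas), h_zero,
    measureReal_neg_eq_measureReal_pos_of_dlap hZmeas hZ] at h_compl
  have h_split : (1 - p) / (1 + p) = 1 - 2 * (p / (1 + p)) := by
    field_simp
    ring
  linarith

end Tails

/-- The bias of the below-threshold indicator estimator is at most `p/(1+p)` in
absolute value. -/
theorem abs_bias_indicator_le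
    {Ω : Type*} [MeasurableSpace Ω] (μ : Measure Ω) [IsProbabilityMeasure μ]
    (p : ℝ) (hp : p ∈ Set.Ioo (0 : ℝ) 1) (lam wT : ℤ)
    (Z : Ω → ℤ) (hZmeas : Measurable Z)
    (hZ : ∀ i : ℤ, μ {ω | Z ω = i} = ENNReal.ofReal (dlapMass p i)) :
    |(∫ ω, (if wT + Z ω < lam then (1 : ℝ) else 0) ∂μ)
        - (if wT < lam then (1 : ℝ) else 0)| ≤ p / (1 + p) := by
  have h_meas : MeasurableSet {ω | wT + Z ω < lam} :=
    measurableSet_lt (measurable_const.add hZmeas) measurable_const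
  have h_int : ∫ ω, (if wT + Z ω < lam then (1 : ℝ) else 0) ∂μ
      = μ.real {ω | wT + Z ω < lam} := by
    simp [← integral_indicator_one h_meas, Set.indicator_apply]
  have h_pos := measureReal_pos_of_dlap hp hZmeas hZ
  rw [h_int]
  split_ifs with h
  · rw [abs_sub_comm, ← probReal_compl_eq_one_sub h_meas, abs_of_nonneg measureReal_nonneg, ← h_pos]
    refine measureReal_mono fun ω hω => ?_
    simp only [Set.mem_compl_iff, Set.mem_ofPred_eq] at hω ⊢
    omega
  · rw [sub_zero, abs_of_nonneg measureReal_nonneg, ← h_pos,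
      ← measureReal_neg_eq_measureReal_pos_of_dlap hZmeas hZ]
    refine measureReal_mono fun ω hω => ?_
    simp only [Set.mem_ofPred_eq] at hω ⊢
    omega
end

section
/- Let p ∈ (0,1), λ ∈ ℤ, w_T ∈ ℤ, and let Z be a ℤ-valued random variable with distribution DLap(p). Then the absolute bias decays exponentially in the distance to the threshold: |E[1{w_T + Z < λ}] - 1{w_T < λ}| ≤ p^{|λ - w_T|}. -/
open MeasureTheory ProbabilityTheory

/-- The upper tail of the discrete Laplace distribution decays geometrically. -/
theorem measureReal_natCast_le_le_pow {Ω : Type*} [MeasurableSpace Ω] (μ : Measure Ω)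
    {p : ℝ} (hp : p ∈ Set.Ioo (0 : ℝ) 1) (Z : Ω → ℤ)
    (hZ : ∀ i : ℤ, μ {ω | Z ω = i} = ENNReal.ofReal (dlapMass p i)) (n : ℕ) :
    μ.real {ω | (n : ℤ) ≤ Z ω} ≤ p ^ n := by
  obtain ⟨hp0, hp1⟩ := hp
  have hset : {ω | (n : ℤ) ≤ Z ω} = ⋃ k : ℕ, {ω | Z ω = ((n + k : ℕ) : ℤ)} := by
    ext ω
    simp only [Set.mem_ofPred_eq, Set.mem_iUnion]
    exact ⟨fun h => ⟨(Z ω - n).toNat, by omega⟩, fun ⟨k, hk⟩ => by omega⟩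
  have hmass (k : ℕ) :
      dlapMass p ((n + k : ℕ) : ℤ) = (1 - p) / (1 + p) * p ^ n * p ^ k := by
    rw [dlapMass, Int.natAbs_natCast, pow_add, mul_assoc]
  have hc : 0 ≤ (1 - p) / (1 + p) := div_nonneg (by linarith) (by linarith)
  have hsum : HasSum (fun k : ℕ => dlapMass p ((n + k : ℕ) : ℤ)) (p ^ n / (1 + p)) := by
    simp only [hmass]
    have hval : p ^ n / (1 + p) = (1 - p) / (1 + p) * p ^ n * (1 - p)⁻¹ := by
      have : 1 - p ≠ 0 := by linarith
      field_simp
    rw [hval]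
    exact (hasSum_geometric_of_lt_one hp0.le hp1).mul_left _
  refine ENNReal.toReal_le_of_le_ofReal (by positivity) ?_
  calc μ {ω | (n : ℤ) ≤ Z ω}
      ≤ ∑' k : ℕ, μ {ω | Z ω = ((n + k : ℕ) : ℤ)} := by
        rw [hset]
        exact measure_iUnion_le _
    _ = ENNReal.ofReal (p ^ n / (1 + p)) := by
        simp only [hZ]
        rw [← ENNReal.ofReal_tsum_of_nonneg _ hsum.summable, hsum.tsum_eq]
        intro k
        rw [hmass]
        positivity
    _ ≤ ENNReal.ofReal (p ^ n) :=
        ENNReal.ofReal_le_ofReal (div_le_self (by positivity) (by linarith))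

/-- The absolute bias of the below-threshold indicator estimator decays
exponentially in the distance `|λ - w_T|` to the threshold. -/
theorem abs_bias_indicator_le_pow
    {Ω : Type*} [MeasurableSpace Ω] (μ : Measure Ω) [IsProbabilityMeasure μ]
    (p : ℝ) (hp : p ∈ Set.Ioo (0 : ℝ) 1) (lam wT : ℤ)
    (Z : Ω → ℤ) (hZmeas : Measurable Z)
    (hZ : ∀ i : ℤ, μ {ω | Z ω = i} = ENNReal.ofReal (dlapMass p i)) :
    |(∫ ω, (if wT + Z ω < lam then (1 : ℝ) else 0) ∂μ)
        - (if wT < lam then (1 : ℝ) else 0)| ≤ p ^ (lam - wT).natAbs := by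
  have hmeas : MeasurableSet {ω | wT + Z ω < lam} :=
    hZmeas (MeasurableSet.of_discrete (s := {z : ℤ | wT + z < lam}))
  have hint : ∫ ω, (if wT + Z ω < lam then (1 : ℝ) else 0) ∂μ = μ.real {ω | wT + Z ω < lam} := by
    rw [← integral_indicator_one hmeas]
    simp only [Set.indicator_apply, Set.mem_ofPred_eq, Pi.one_apply]
  rw [hint]
  split_ifs with h
  · rw [abs_sub_comm, ← probReal_compl_eq_one_sub hmeas, abs_of_nonneg measureReal_nonneg]
    convert measureReal_natCast_le_le_pow μ hp Z hZ (lam - wT).natAbs using 2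
    ext ω
    simp only [Set.mem_compl_iff, Set.mem_ofPred_eq]
    omega
  · have hneg (i : ℤ) : μ {ω | -Z ω = i} = ENNReal.ofReal (dlapMass p i) := by
      simpa [neg_eq_iff_eq_neg, dlapMass] using hZ (-i)
    rw [sub_zero, abs_of_nonneg measureReal_nonneg]
    refine (measureReal_mono fun ω hω => ?_).trans
      (measureReal_natCast_le_le_pow μ hp (fun ω => -Z ω) hneg (lam - wT).natAbs)
    simp only [Set.mem_ofPred_eq] at hω ⊢
    omega
end

section
/- Let p ∈ (0,1), λ ∈ ℤ, w_T, w_{T'} ∈ ℤ, and let Z be a single ℤ-valued random variable with distribution DLap(p). Then the covariance of the two estimators that share the same noise satisfies 0 ≤ Cov[1{w_T + Z < λ}, 1{w_{T'} + Z < λ}] ≤ 2p/(1+p). -/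
open MeasureTheory ProbabilityTheory

/-- The covariance of two real-valued random variables, `E[XY] - E[X]·E[Y]`. -/
noncomputable def cov {Ω : Type*} [MeasurableSpace Ω] (μ : Measure Ω)
    (X Y : Ω → ℝ) : ℝ :=
  (∫ ω, X ω * Y ω ∂μ) - (∫ ω, X ω ∂μ) * (∫ ω, Y ω ∂μ)

theorem cov_comm {Ω : Type*} [MeasurableSpace Ω] (μ : Measure Ω) (X Y : Ω → ℝ) :
    cov μ X Y = cov μ Y X := by
  simp only [cov, mul_comm]

/-- The covariance of the indicators of nested events `A ⊆ B` is `μ A * μ Bᶜ`. -/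
theorem cov_indicator_of_subset {Ω : Type*} [MeasurableSpace Ω] (μ : Measure Ω)
    [IsProbabilityMeasure μ] {A B : Set Ω} (hA : MeasurableSet A) (hB : MeasurableSet B)
    (hAB : A ⊆ B) :
    cov μ (A.indicator 1) (B.indicator 1) = μ.real A * μ.real Bᶜ := by
  have hmul : (fun ω => A.indicator (1 : Ω → ℝ) ω * B.indicator (1 : Ω → ℝ) ω)
      = A.indicator 1 := by
    funext ω
    by_cases h : ω ∈ A
    · simp [h, hAB h]
    · simp [h]
  rw [cov, hmul, integral_indicator_one hA, integral_indicator_one hB,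
    probReal_compl_eq_one_sub hB]
  ring

theorem cov_threshold_bounds_of_le {Ω : Type*} [MeasurableSpace Ω] (μ : Measure Ω)
    [IsProbabilityMeasure μ] {Z : Ω → ℤ} (hZ : Measurable Z) {a b : ℤ} (hab : a ≤ b) :
    0 ≤ cov μ ({ω | Z ω < a}.indicator 1) ({ω | Z ω < b}.indicator 1) ∧
    cov μ ({ω | Z ω < a}.indicator 1) ({ω | Z ω < b}.indicator 1) ≤
      μ.real {ω | Z ω = 0}ᶜ := by
  have hmeas (c : ℤ) : MeasurableSet {ω | Z ω < c} := hZ measurableSet_Iio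
  rw [cov_indicator_of_subset μ (hmeas a) (hmeas b)
    fun ω (h : Z ω < a) => h.trans_le hab]
  refine ⟨by positivity, ?_⟩
  rcases le_or_gt a 0 with ha | ha
  · refine (mul_le_of_le_one_right measureReal_nonneg measureReal_le_one).trans
      (measureReal_mono fun ω (h : Z ω < a) => ?_)
    simp only [Set.mem_compl_iff, Set.mem_ofPred_eq]
    lia
  · refine (mul_le_of_le_one_left measureReal_nonneg measureReal_le_one).trans
      (measureReal_mono fun ω (h : ¬ Z ω < b) => ?_)
    simp only [Set.mem_compl_iff, Set.mem_ofPred_eq]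
    lia

/-- The covariance of two below-threshold indicator estimators sharing the same
discrete Laplace noise is nonnegative and at most `2p/(1+p)`. -/
theorem covariance_indicator_shared_noise
    {Ω : Type*} [MeasurableSpace Ω] (μ : Measure Ω) [IsProbabilityMeasure μ]
    (p : ℝ) (hp : p ∈ Set.Ioo (0 : ℝ) 1) (lam wT wT' : ℤ)
    (Z : Ω → ℤ) (hZmeas : Measurable Z)
    (hZ : ∀ i : ℤ, μ {ω | Z ω = i} = ENNReal.ofReal (dlapMass p i)) :
    0 ≤ cov μ (fun ω => if wT + Z ω < lam then (1 : ℝ) else 0)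
          (fun ω => if wT' + Z ω < lam then (1 : ℝ) else 0) ∧
    cov μ (fun ω => if wT + Z ω < lam then (1 : ℝ) else 0)
          (fun ω => if wT' + Z ω < lam then (1 : ℝ) else 0) ≤ 2 * p / (1 + p) := by
  obtain ⟨hp0, hp1⟩ := hp
  have hnonzero : μ.real {ω | Z ω = 0}ᶜ = 2 * p / (1 + p) := by
    have hmass : 0 ≤ (1 - p) / (1 + p) := div_nonneg (by linarith) (by linarith)
    have hmeas : MeasurableSet {ω | Z ω = 0} := hZmeas (measurableSet_singleton 0)
    rw [probReal_compl_eq_one_sub hmeas, measureReal_def, hZ]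
    simp only [dlapMass, Int.natAbs_zero, pow_zero, mul_one, ENNReal.toReal_ofReal hmass]
    field_simp
    ring
  have hind (w : ℤ) : (fun ω => if w + Z ω < lam then (1 : ℝ) else 0)
      = {ω | Z ω < lam - w}.indicator 1 := by
    funext ω
    simp [Set.indicator_apply, lt_sub_iff_add_lt']
  rw [hind, hind, ← hnonzero]
  rcases le_total (lam - wT) (lam - wT') with h | h
  · exact cov_threshold_bounds_of_le μ hZmeas h
  · rw [cov_comm]
    exact cov_threshold_bounds_of_le μ hZmeas h
end

section
/- Let p ∈ (0,1), λ ∈ ℤ, m ∈ ℤ, and let Z be a ℤ-valued random variable with distribution DLap(p). Then the estimator h(m + Z) is unbiased for the below-threshold indicator: E[h(m + Z)] = 1{m < λ}. -/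
open MeasureTheory ProbabilityTheory

/-- The debiasing function `h` for the below-threshold indicator:
`h(m) = 0` for `m > λ`, `h(λ) = -p/(1-p)²`, `h(λ-1) = 1 + p/(1-p)²`,
and `h(m) = 1` for `m < λ - 1`. -/
noncomputable def hFun (p : ℝ) (lam : ℤ) (m : ℤ) : ℝ :=
  if lam < m then 0
  else if m = lam then -(p / (1 - p) ^ 2)
  else if m = lam - 1 then 1 + p / (1 - p) ^ 2
  else 1

/-- The mass of a one-sided tail of a discrete Laplace variable, the tail being enumerated
by `f` in order of increasing absolute value starting at `a`. -/
theorem measureReal_tail_of_dlapMass {Ω : Type*} [MeasurableSpace Ω] (μ : Measure Ω)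
    {p : ℝ} (hp : p ∈ Set.Ioo (0 : ℝ) 1) {Z : Ω → ℤ} (hZmeas : Measurable Z)
    (hZ : ∀ i : ℤ, μ {ω | Z ω = i} = ENNReal.ofReal (dlapMass p i))
    {f : ℕ → ℤ} {a : ℕ} (hf : ∀ n, (f n).natAbs = a + n) {s : Set Ω}
    (hs : ∀ ω, ω ∈ s ↔ ∃ n, Z ω = f n) :
    μ.real s = p ^ a / (1 + p) := by
  obtain ⟨hp0, hp1⟩ := hp
  have hpos : 0 < 1 - p := by linarith
  have hs_eq : s = ⋃ n, {ω | Z ω = f n} := by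
    ext ω
    simp [hs]
  have hsum : HasSum (fun n => dlapMass p (f n)) (p ^ a / (1 + p)) := by
    have h := (hasSum_geometric_of_lt_one hp0.le hp1).mul_left ((1 - p) / (1 + p) * p ^ a)
    have hval : (1 - p) / (1 + p) * p ^ a * (1 - p)⁻¹ = p ^ a / (1 + p) := by field_simp
    rw [hval] at h
    simpa only [dlapMass, hf, pow_add, mul_assoc] using h
  have hdisj : Pairwise (Function.onFun Disjoint fun n => {ω | Z ω = f n}) := by
    intro i j hij
    refine Set.disjoint_left.2 fun ω (hi : Z ω = f i) (hj : Z ω = f j) => hij ?_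
    have h := hf i
    rw [← hi, hj, hf j] at h
    omega
  have hmass (n : ℕ) : 0 ≤ dlapMass p (f n) := by
    unfold dlapMass
    positivity
  rw [measureReal_def, hs_eq,
    measure_iUnion hdisj fun n => hZmeas (measurableSet_singleton (f n))]
  simp_rw [hZ]
  rw [← ENNReal.ofReal_tsum_of_nonneg hmass hsum.summable, hsum.tsum_eq,
    ENNReal.toReal_ofReal (by positivity)]

/-- The debiasing function is the below-threshold indicator plus a correction supported
on `{lam - 1, lam}`. -/
theorem hFun_add_eq_indicator (p : ℝ) (lam m z : ℤ) :
    hFun p lam (m + z) = Set.indicator {x : ℤ | x < lam - m} 1 z +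
      p / (1 - p) ^ 2 * (Set.indicator {x : ℤ | x = lam - m - 1} 1 z -
        Set.indicator {x : ℤ | x = lam - m} 1 z) := by
  simp only [hFun, Set.indicator_apply, Set.mem_ofPred_eq, Pi.one_apply]
  split_ifs <;> first | omega | ring

/-- The estimator `h(m + Z)` is unbiased for the below-threshold indicator. -/
theorem unbiased_estimator
    {Ω : Type*} [MeasurableSpace Ω] (μ : Measure Ω) [IsProbabilityMeasure μ]
    (p : ℝ) (hp : p ∈ Set.Ioo (0 : ℝ) 1) (lam m : ℤ)
    (Z : Ω → ℤ) (hZmeas : Measurable Z)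
    (hZ : ∀ i : ℤ, μ {ω | Z ω = i} = ENNReal.ofReal (dlapMass p i)) :
    (∫ ω, hFun p lam (m + Z ω) ∂μ) = if m < lam then (1 : ℝ) else 0 := by
  have hp' := hp
  obtain ⟨hp0, hp1⟩ := hp'
  have hpos : 0 < 1 - p := by linarith
  have hmeas (s : Set ℤ) : MeasurableSet (Z ⁻¹' s) := hZmeas s.to_countable.measurableSet
  have hint (s : Set ℤ) : Integrable (fun ω => Set.indicator s (1 : ℤ → ℝ) (Z ω)) μ :=
    (integrable_const (1 : ℝ)).indicator (hmeas s)
  have hsub (s t : Set ℤ) : Integrable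
      (fun ω => Set.indicator s (1 : ℤ → ℝ) (Z ω) - Set.indicator t 1 (Z ω)) μ :=
    (hint s).sub (hint t)
  have hval (s : Set ℤ) : ∫ ω, Set.indicator s (1 : ℤ → ℝ) (Z ω) ∂μ = μ.real (Z ⁻¹' s) :=
    integral_indicator_one (hmeas s)
  have hpt (i : ℤ) : μ.real (Z ⁻¹' {x | x = i}) = dlapMass p i := by
    have h0 : 0 ≤ dlapMass p i := by
      unfold dlapMass
      positivity
    rw [measureReal_def, Set.preimage_ofPred_eq, hZ, ENNReal.toReal_ofReal h0]
  simp_rw [hFun_add_eq_indicator]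
  rw [integral_add (hint _) ((hsub _ _).const_mul _), integral_const_mul,
    integral_sub (hint _) (hint _), hval, hval, hval, hpt, hpt]
  split_ifs with h
  · obtain ⟨k, hk⟩ : ∃ k : ℕ, lam - m = k + 1 := ⟨(lam - m - 1).toNat, by omega⟩
    have htail : μ.real (Z ⁻¹' {x | x < lam - m})ᶜ = p ^ (k + 1) / (1 + p) :=
      measureReal_tail_of_dlapMass μ hp hZmeas hZ (f := fun n => k + 1 + n)
        (fun n => by omega) fun ω => by
          simp only [Set.mem_compl_iff, Set.mem_preimage, Set.mem_ofPred_eq]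
          exact ⟨fun hω => ⟨(Z ω - (k + 1)).toNat, by omega⟩, fun ⟨n, hn⟩ => by omega⟩
    rw [probReal_compl_eq_one_sub (hmeas _)] at htail
    have h1 : (lam - m - 1).natAbs = k := by omega
    have h2 : (lam - m).natAbs = k + 1 := by omega
    rw [show μ.real (Z ⁻¹' {x | x < lam - m}) = 1 - p ^ (k + 1) / (1 + p) by linarith,
      dlapMass, dlapMass, h1, h2]
    field_simp
    ring
  · obtain ⟨k, hk⟩ : ∃ k : ℕ, lam - m = -k := ⟨(m - lam).toNat, by omega⟩
    have htail : μ.real (Z ⁻¹' {x | x < lam - m}) = p ^ (k + 1) / (1 + p) :=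
      measureReal_tail_of_dlapMass μ hp hZmeas hZ (f := fun n => -(k + 1 + n))
        (fun n => by omega) fun ω => by
          simp only [Set.mem_preimage, Set.mem_ofPred_eq]
          exact ⟨fun hω => ⟨(-(k + 1) - Z ω).toNat, by omega⟩, fun ⟨n, hn⟩ => by omega⟩
    have h1 : (lam - m - 1).natAbs = k + 1 := by omega
    have h2 : (lam - m).natAbs = k := by omega
    rw [htail, dlapMass, dlapMass, h1, h2]
    field_simp
    ring
end

section
/- Let d ≥ 1, λ ∈ ℤ, let S be a finite index set, and for each T ∈ S fix two distinct indices a_T, b_T ∈ {1, …, d} and a constant c_T ∈ ℤ, such that the map T ↦ {a_T, b_T} is injective on S. Define f : ℤ^d → ℝ by f(w) = ∑_{T ∈ S} 1{w_{a_T} + w_{b_T} + c_T < λ}. Then the global sensitivity of f equals GS(f) := sup{ |f(w) - f(w')| : w, w' ∈ ℤ^d, ‖w - w'‖₁ ≤ 1 } = max_{i ∈ {1,…,d}} |{T ∈ S : i ∈ {a_T, b_T}}|. -/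
open Finset

/-- Integer vectors at `ℓ1` distance at most one agree off a single coordinate. -/
lemma exists_forall_ne_eq_of_sum_abs_sub_le_one {κ : Type*} [Fintype κ] [Nonempty κ]
    {w w' : κ → ℤ} (h : ∑ i, |w i - w' i| ≤ 1) : ∃ i, ∀ j, j ≠ i → w j = w' j := by
  classical
  by_cases hw : ∃ i, w i ≠ w' i
  · obtain ⟨i, hi⟩ := hw
    refine ⟨i, fun j hj => ?_⟩
    by_contra hne
    have hpair : ∑ k ∈ ({i, j} : Finset κ), |w k - w' k| ≤ ∑ k, |w k - w' k| :=
      Finset.sum_le_sum_of_subset_of_nonneg (Finset.subset_univ _) fun _ _ _ => abs_nonneg _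
    rw [Finset.sum_pair hj.symm] at hpair
    have h₁ : 0 < |w i - w' i| := abs_pos.mpr (sub_ne_zero.mpr hi)
    have h₂ : 0 < |w j - w' j| := abs_pos.mpr (sub_ne_zero.mpr hne)
    omega
  · push Not at hw
    exact ⟨Classical.arbitrary κ, fun j _ => hw j⟩

/-- Changing a single weight `i` changes the below-threshold count by at most the number of
pairs that contain `i`. -/
lemma abs_sum_ite_sub_sum_ite_le_card {κ ι : Type*} [DecidableEq κ] (lam : ℤ) (S : Finset ι)
    (a b : ι → κ) (c : ι → ℤ) {w w' : κ → ℤ} {i : κ} (h : ∀ j, j ≠ i → w j = w' j) :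
    |(∑ T ∈ S, if w (a T) + w (b T) + c T < lam then (1 : ℝ) else 0) -
      (∑ T ∈ S, if w' (a T) + w' (b T) + c T < lam then (1 : ℝ) else 0)| ≤
      ((S.filter fun T => a T = i ∨ b T = i).card : ℝ) := by
  rw [← Finset.sum_sub_distrib, Finset.card_filter, Nat.cast_sum]
  refine (Finset.abs_sum_le_sum_abs _ _).trans (Finset.sum_le_sum fun T _ => ?_)
  by_cases hT : a T = i ∨ b T = i
  · rw [if_pos hT]
    split_ifs <;> norm_num
  · rw [if_neg hT]
    push Not at hT
    rw [h _ hT.1, h _ hT.2]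
    simp

/-- If the pairs are distinct, there are weights vanishing at `i` for which every pair containing
`i` lies just below the threshold. -/
lemma exists_weights_just_below_threshold {κ ι : Type*} [DecidableEq κ] (lam : ℤ) (S : Finset ι)
    (a b : ι → κ) (c : ι → ℤ) (hab : ∀ T ∈ S, a T ≠ b T)
    (hinj : Set.InjOn (fun T => ({a T, b T} : Finset κ)) S) (i : κ) :
    ∃ w : κ → ℤ, w i = 0 ∧ ∀ T ∈ S, a T = i ∨ b T = i →
      w (a T) + w (b T) + c T = lam - 1 := by
  classical
  let w : κ → ℤ := fun j =>
    if j = i then 0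
    else if h : ∃ T ∈ S, ({a T, b T} : Finset κ) = {i, j} then lam - 1 - c h.choose else 0
  have hw : ∀ T ∈ S, ∀ j, j ≠ i → ({a T, b T} : Finset κ) = {i, j} → w j = lam - 1 - c T := by
    intro T hT j hj hTj
    have hex : ∃ T ∈ S, ({a T, b T} : Finset κ) = {i, j} := ⟨T, hT, hTj⟩
    have heq : hex.choose = T :=
      hinj hex.choose_spec.1 hT (hex.choose_spec.2.trans hTj.symm)
    simp only [w, if_neg hj, dif_pos hex, heq]
  have hwi : w i = 0 := if_pos rfl
  refine ⟨w, hwi, fun T hT hTi => ?_⟩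
  rcases hTi with h | h
  · have := hw T hT (b T) (fun e => hab T hT (h.trans e.symm)) (by rw [h])
    rw [h, hwi, this]
    ring
  · have := hw T hT (a T) (fun e => hab T hT (e.trans h.symm)) (by rw [h, Finset.pair_comm])
    rw [h, hwi, this]
    ring

/-- Some neighboring weights differing only at `i` flip every pair that contains `i`. -/
lemma exists_neighbors_abs_sum_ite_sub_eq_card {κ ι : Type*} [Fintype κ] [DecidableEq κ]
    (lam : ℤ) (S : Finset ι) (a b : ι → κ) (c : ι → ℤ) (hab : ∀ T ∈ S, a T ≠ b T)
    (hinj : Set.InjOn (fun T => ({a T, b T} : Finset κ)) S) (i : κ) :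
    ∃ w w' : κ → ℤ, (∑ i, |w i - w' i|) ≤ 1 ∧
      ((S.filter fun T => a T = i ∨ b T = i).card : ℝ) =
        |(∑ T ∈ S, if w (a T) + w (b T) + c T < lam then (1 : ℝ) else 0) -
          (∑ T ∈ S, if w' (a T) + w' (b T) + c T < lam then (1 : ℝ) else 0)| := by
  obtain ⟨w, hwi, hw⟩ := exists_weights_just_below_threshold lam S a b c hab hinj i
  refine ⟨w, Function.update w i 1, ?_, ?_⟩
  · rw [Finset.sum_eq_single i (fun j _ hj => by simp [hj]) (by simp)]
    simp [hwi]
  · rw [← Finset.sum_sub_distrib, Finset.card_filter, Nat.cast_sum, ← abs_of_nonneg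
      (Finset.sum_nonneg fun T _ => Nat.cast_nonneg (α := ℝ) (if a T = i ∨ b T = i then 1 else 0))]
    congr 1
    refine Finset.sum_congr rfl fun T hT => ?_
    by_cases hTi : a T = i ∨ b T = i
    · have hbelow := hw T hT hTi
      have habove : Function.update w i 1 (a T) + Function.update w i 1 (b T) + c T = lam := by
        rcases hTi with h | h
        · have hb : b T ≠ i := fun e => hab T hT (h.trans e.symm)
          rw [h, hwi] at hbelow
          rw [h, Function.update_self, Function.update_of_ne hb]
          omega
        · have ha : a T ≠ i := fun e => hab T hT (e.trans h.symm)
          rw [h, hwi] at hbelow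
          rw [h, Function.update_self, Function.update_of_ne ha]
          omega
      rw [habove, hbelow, if_pos hTi, if_pos (by omega), if_neg (lt_irrefl _)]
      simp
    · rw [if_neg hTi]
      push Not at hTi
      rw [Function.update_of_ne hTi.1, Function.update_of_ne hTi.2]
      simp

/-- The global sensitivity of the local below-threshold count (biased estimator)
equals the maximum number of counted triangles sharing a single incident edge. -/
theorem global_sensitivity_biased_count
    (d : ℕ) (hd : 1 ≤ d) (lam : ℤ) {ι : Type*} (S : Finset ι)
    (a b : ι → Fin d) (c : ι → ℤ)
    (hab : ∀ T ∈ S, a T ≠ b T)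
    (hinj : Set.InjOn (fun T => ({a T, b T} : Finset (Fin d))) S) :
    sSup {x : ℝ | ∃ w w' : Fin d → ℤ, (∑ i, |w i - w' i|) ≤ 1 ∧
        x = |(∑ T ∈ S, if w (a T) + w (b T) + c T < lam then (1 : ℝ) else 0) -
             (∑ T ∈ S, if w' (a T) + w' (b T) + c T < lam then (1 : ℝ) else 0)|} =
      ((Finset.univ.sup fun i : Fin d =>
        (S.filter fun T => a T = i ∨ b T = i).card) : ℕ) := by
  have : Nonempty (Fin d) := ⟨⟨0, hd⟩⟩
  refine IsGreatest.csSup_eq ⟨?_, ?_⟩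
  · obtain ⟨i, -, hi⟩ := Finset.exists_mem_eq_sup Finset.univ Finset.univ_nonempty
      fun i : Fin d => (S.filter fun T => a T = i ∨ b T = i).card
    rw [hi]
    exact exists_neighbors_abs_sum_ite_sub_eq_card lam S a b c hab hinj i
  · rintro x ⟨w, w', hww', rfl⟩
    obtain ⟨i, hi⟩ := exists_forall_ne_eq_of_sum_abs_sub_le_one hww'
    refine (abs_sum_ite_sub_sum_ite_le_card lam S a b c hi).trans (Nat.cast_le.mpr ?_)
    exact Finset.le_sup (f := fun i : Fin d => (S.filter fun T => a T = i ∨ b T = i).card)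
      (Finset.mem_univ i)
end

section
/- Let β > 0, λ ∈ ℤ, w_i ∈ ℤ, let J be a finite nonempty index set, and let c_j ∈ ℤ for each j ∈ J. Define F : ℤ × ℤ^J → ℝ by F(z_i, z) = (∑_{j ∈ J} 1{c_j + z_j = λ - 1 - w_i - z_i}) · exp(-β(|z_i| + ∑_{j ∈ J} |z_j|)). Then F attains its supremum over ℤ × ℤ^J, and there exists a maximizer (z_i*, z*) such that z_i* = 0 or z_i* = λ - 1 - w_i - c_j for some j ∈ J (equivalently, the target λ - 1 - w_i - z_i* equals λ - 1 - w_i or equals c_j for some j ∈ J). -/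
open Finset

/-- A sum of absolute deviations from integer points is at most as large at one of these points
as at any given integer. -/
theorem exists_sum_abs_sub_le {ι : Type*} (s : Finset ι) (hs : s.Nonempty) (x : ι → ℤ) (t : ℤ) :
    ∃ i ∈ s, ∑ k ∈ s, |x k - x i| ≤ ∑ k ∈ s, |x k - t| := by
  classical
  rcases (s.filter fun k => x k ≤ t).eq_empty_or_nonempty with hl | hl
  · obtain ⟨i, hi, hmin⟩ := s.exists_min_image x hs
    refine ⟨i, hi, sum_le_sum fun k hk => ?_⟩
    have hti := filter_eq_empty_iff.mp hl hi
    have := hmin k hk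
    grind
  rcases (s.filter fun k => t ≤ x k).eq_empty_or_nonempty with hu | hu
  · obtain ⟨i, hi, hmax⟩ := s.exists_max_image x hs
    refine ⟨i, hi, sum_le_sum fun k hk => ?_⟩
    have hti := filter_eq_empty_iff.mp hu hi
    have := hmax k hk
    grind
  obtain ⟨l, hl, hmax⟩ := exists_max_image _ x hl
  obtain ⟨u, hu, hmin⟩ := exists_min_image _ x hu
  simp only [mem_filter] at hl hu hmax hmin
  by_contra! h
  have hL := h l hl.1
  have hU := h u hu.1
  have key : (x u - t) * ∑ k ∈ s, |x k - x l| + (t - x l) * ∑ k ∈ s, |x k - x u|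
      = (x u - x l) * ∑ k ∈ s, |x k - t| := by
    simp only [mul_sum, ← sum_add_distrib]
    refine sum_congr rfl fun k hk => ?_
    rcases le_total (x k) t with hkt | hkt
    · have := hmax k ⟨hk, hkt⟩
      rw [abs_of_nonpos (by lia : x k - x l ≤ 0), abs_of_nonpos (by lia : x k - x u ≤ 0),
        abs_of_nonpos (by lia : x k - t ≤ 0)]
      ring
    · have := hmin k ⟨hk, hkt⟩
      rw [abs_of_nonneg (by lia : 0 ≤ x k - x l), abs_of_nonneg (by lia : 0 ≤ x k - x u),
        abs_of_nonneg (by lia : 0 ≤ x k - t)]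
      ring
  rcases hl.2.eq_or_lt with hlt | hlt
  · rw [hlt] at hL
    exact lt_irrefl _ hL
  · nlinarith [mul_lt_mul_of_pos_left hU (sub_pos.mpr hlt),
      mul_le_mul_of_nonneg_left hL.le (sub_nonneg.mpr hu.2)]

/-- The inner optimization problem in the smooth-sensitivity computation attains
its supremum, and some maximizer has target `λ - 1 - w_i` (i.e. `z_i = 0`) or
target `c_j` for some `j`. -/
theorem smooth_sensitivity_optimal_target
    (β : ℝ) (hβ : 0 < β) (lam wi : ℤ)
    {J : Type*} [Fintype J] [Nonempty J] (c : J → ℤ) :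
    ∃ (zi : ℤ) (z : J → ℤ),
      (∀ (zi' : ℤ) (z' : J → ℤ),
        ((∑ j, if c j + z' j = lam - 1 - wi - zi' then (1 : ℝ) else 0) *
            Real.exp (-β * ((|zi'| + ∑ j, |z' j| : ℤ) : ℝ))) ≤
        ((∑ j, if c j + z j = lam - 1 - wi - zi then (1 : ℝ) else 0) *
            Real.exp (-β * ((|zi| + ∑ j, |z j| : ℤ) : ℝ)))) ∧
      (zi = 0 ∨ ∃ j, zi = lam - 1 - wi - c j) := by
  classical
  let a : Option J → ℤ := fun o => o.elim 0 fun j => lam - 1 - wi - c j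
  let y : Option J × Finset J → J → ℤ := fun p j => if j ∈ p.2 then a (some j) - a p.1 else 0
  let F : ℤ → (J → ℤ) → ℝ := fun t z =>
    (∑ j, if c j + z j = lam - 1 - wi - t then (1 : ℝ) else 0) *
      Real.exp (-β * ((|t| + ∑ j, |z j| : ℤ) : ℝ))
  obtain ⟨p, hp⟩ := Finite.exists_max fun p : Option J × Finset J => F (a p.1) (y p)
  refine ⟨a p.1, y p, fun t z => ?_, ?_⟩
  · let S : Finset J := univ.filter fun j => c j + z j = lam - 1 - wi - t
    obtain ⟨o, -, ho⟩ := exists_sum_abs_sub_le (insertNone S) ⟨none, by simp⟩ a t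
    refine le_trans ?_ (hp (o, S))
    have hcost : |a o| + ∑ j, |y (o, S) j| ≤ |t| + ∑ j, |z j| := by
      have h₁ : ∑ j, |y (o, S) j| = ∑ j ∈ S, |a (some j) - a o| := by
        simp [y, apply_ite abs, sum_ite_mem]
      have h₂ : ∑ j ∈ S, |a (some j) - t| ≤ ∑ j, |z j| := by
        refine (sum_congr rfl fun j hj => ?_).trans_le
          (sum_le_sum_of_subset_of_nonneg (subset_univ S) fun j _ _ => abs_nonneg (z j))
        have : c j + z j = lam - 1 - wi - t := (mem_filter.mp hj).2
        congr 1
        simp only [a, Option.elim_some]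
        lia
      have h₃ : a none = 0 := rfl
      simp only [sum_insertNone, h₃, zero_sub, abs_neg] at ho
      lia
    refine mul_le_mul (sum_le_sum fun j _ => ?_) ?_ (Real.exp_pos _).le
      (sum_nonneg fun j _ => by split_ifs <;> norm_num)
    · by_cases hj : c j + z j = lam - 1 - wi - t
      · have hjS : j ∈ S := mem_filter.mpr ⟨mem_univ j, hj⟩
        have hy : c j + y (o, S) j = lam - 1 - wi - a o := by
          simp only [y, hjS, if_true, a, Option.elim_some]
          ring
        rw [if_pos hj, if_pos hy]
      · rw [if_neg hj]
        split_ifs <;> norm_num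
    · refine Real.exp_le_exp.mpr (mul_le_mul_of_nonpos_left ?_ (neg_nonpos.mpr hβ.le))
      exact_mod_cast hcost
  · rcases p with ⟨_ | j, S⟩
    · exact Or.inl rfl
    · exact Or.inr ⟨j, rfl⟩
end
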